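/- Let b > 1, r ∈ R_n, λ = λ(r) = (1 + τ(r))⁻¹, z = z(r) = #{i : rᵢ = 0}, t ∈ ℕ, u ∈ ℝ with 1 ≤ λu ≤ t, and c(n) = 4^{n+1}(n+1)^{(n+1)/2}(n+1)!. Write g^t = g^t_{r,b} and let [·] denote integer part. Let Λ be a discrete subgroup of ℝ^{n+1} such that rank Λ ≤ n − z and δ(g^{t−[λu]} Λ) ≥ 1. Then #((g^t Λ) ∩ Π(b,u)) ≤ 2 c(n) b^{τ(r)} b^{λu}. -/

import Mathlib

open ENNReal

/-- The set `R_n` of weight vectors: nonnegative components summing to `1`. -/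
def Weights (n : ℕ) : Set (Fin n → ℝ) := {r | (∑ i, r i) = 1 ∧ ∀ i, 0 ≤ r i}

/-- `τ(r)`: the smallest strictly positive component of `r`. -/
noncomputable def tauW {n : ℕ} (r : Fin n → ℝ) : ℝ := sInf {t | 0 < t ∧ ∃ i, r i = t}

/-- `z(r)`: the number of zero components of `r`. -/
noncomputable def zW {n : ℕ} (r : Fin n → ℝ) : ℕ :=
  (Finset.univ.filter fun i => r i = 0).card

/-- `δ(Λ) = inf {‖a‖_∞ : a ∈ Λ, a ≠ 0}` (valued in `ℝ≥0∞`, so `δ({0}) = ∞`);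
the norm on `Fin d → ℝ` is the sup norm. -/
noncomputable def latDelta {d : ℕ} (Λ : Set (Fin d → ℝ)) : ℝ≥0∞ :=
  ⨅ a ∈ (Λ \ {0}), (‖a‖₊ : ℝ≥0∞)

/-- The diagonal matrix `g^s_{r,b} = diag(b^s, b^{-r₁ s}, …, b^{-rₙ s})`. -/
noncomputable def gmat {n : ℕ} (r : Fin n → ℝ) (b : ℝ) (s : ℝ) :
    Matrix (Fin (n + 1)) (Fin (n + 1)) ℝ :=
  Matrix.diagonal (Fin.cases (b ^ s) fun i => b ^ (-(r i) * s))

/-- The image of a subset of `ℝ^d` under (multiplication by) a matrix. -/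
def latImage {d : ℕ} (A : Matrix (Fin d) (Fin d) ℝ) (Λ : Set (Fin d → ℝ)) :
    Set (Fin d → ℝ) := (fun v => A.mulVec v) '' Λ

/-- The box `Π(b,u) = Π_θ` with `θ = (b^u, 1, …, 1)`. -/
noncomputable def PiBU (n : ℕ) (b u : ℝ) : Set (Fin (n + 1) → ℝ) :=
  {x | |x 0| < b ^ u ∧ ∀ i : Fin n, |x i.succ| < 1}

/-- The constant `c(n) = 4^{n+1} (n+1)^{(n+1)/2} (n+1)!`. -/
noncomputable def cConst (n : ℕ) : ℝ :=
  4 ^ (n + 1) * ((n : ℝ) + 1) ^ (((n : ℝ) + 1) / 2) * (Nat.factorial (n + 1) : ℝ)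

theorem aux_fact_sq (N : ℕ) : N ^ N ≤ (N.factorial) ^ 2 := by
  have h1 : ∏ i ∈ Finset.range N, (i + 1) = N.factorial := Finset.prod_range_add_one_eq_factorial N
  have h2 : ∏ i ∈ Finset.range N, (N - 1 - i + 1) = N.factorial := by
    rw [← h1, ← Finset.prod_range_reflect (fun i => i + 1) N]
  have h3 : N.factorial ^ 2 = ∏ i ∈ Finset.range N, ((i + 1) * (N - 1 - i + 1)) := by
    rw [Finset.prod_mul_distrib, h1, h2, sq]
  rw [h3]
  have : N ^ N = ∏ _i ∈ Finset.range N, N := by simp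
  rw [this]
  apply Finset.prod_le_prod'
  intro i hi
  have hi : i < N := Finset.mem_range.1 hi
  obtain ⟨m, rfl⟩ : ∃ m, N = i + 1 + m := ⟨N - (i + 1), by omega⟩
  have : i + 1 + m - 1 - i + 1 = m + 1 := by omega
  rw [this]
  nlinarith [Nat.zero_le (m * i)]

theorem aux_const (n : ℕ) : (4 * ((n : ℝ) + 1)) ^ (n + 1) ≤ cConst n := by
  unfold cConst
  have hN : (0 : ℝ) ≤ (n : ℝ) + 1 := by positivity
  have h := aux_fact_sq (n + 1)
  have h' : ((n : ℝ) + 1) ^ (n + 1) ≤ ((n + 1).factorial : ℝ) ^ 2 := by exact_mod_cast h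
  set H := ((n : ℝ) + 1) ^ (((n : ℝ) + 1) / 2) with hH
  have hH0 : 0 ≤ H := by positivity
  have hHH : H ^ 2 = ((n : ℝ) + 1) ^ (n + 1) := by
    rw [hH, ← Real.rpow_natCast, ← Real.rpow_mul hN, ← Real.rpow_natCast]
    congr 1
    push_cast
    ring
  have h3 : H ≤ ((n + 1).factorial : ℝ) := by
    apply le_of_sq_le_sq _ (by positivity)
    rw [hHH]; exact h'
  rw [mul_pow, ← hHH, mul_assoc, sq]
  gcongr

theorem aux_minor {d : ℕ} (s : Set (Fin d → ℝ)) :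
    ∃ f : Fin (Module.finrank ℝ (Submodule.span ℝ s)) → Fin d, Function.Injective f ∧
      ∀ y ∈ Submodule.span ℝ s, ∀ j, |y j| ≤ ∑ i, |y (f i)| := by
  obtain ⟨v, -, hspan, hli⟩ := Submodule.exists_fun_fin_finrank_span_eq ℝ s
  revert v
  generalize Module.finrank ℝ (Submodule.span ℝ s) = k
  intro v hspan hli
  rw [← hspan]
  let A : Matrix (Fin k) (Fin d) ℝ := Matrix.of v
  have hrk : Module.finrank ℝ (Submodule.span ℝ (Set.range A.col)) = k := by
    rw [← Matrix.rank_eq_finrank_span_cols, LinearIndependent.rank_matrix (M := A) hli]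
    simp
  have hex := Submodule.exists_fun_fin_finrank_span_eq ℝ (Set.range A.col)
  rw [hrk] at hex
  obtain ⟨g, hg, -, hgli⟩ := hex
  choose f0 hf0 using hg
  have hdet0 : (A.submatrix id f0).det ≠ 0 := by
    have : IsUnit (A.submatrix id f0) := by
      rw [← Matrix.linearIndependent_cols_iff_isUnit]
      have : (A.submatrix id f0).col = g := by
        funext i
        rw [← hf0 i]
        rfl
      rw [this]; exact hgli
    exact ((Matrix.isUnit_iff_isUnit_det _).1 this).ne_zero
  obtain ⟨f, -, hf⟩ := Finset.exists_max_image (Finset.univ : Finset (Fin k → Fin d))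
    (fun f => |(A.submatrix id f).det|) ⟨f0, Finset.mem_univ _⟩
  have hD : 0 < |(A.submatrix id f).det| :=
    lt_of_lt_of_le (abs_pos.2 hdet0) (hf f0 (Finset.mem_univ _))
  refine ⟨f, ?_, ?_⟩
  · intro i j hij
    by_contra hne
    apply abs_pos.1 hD
    apply Matrix.det_zero_of_column_eq hne
    intro l
    simp [hij]
  · intro y hy j
    obtain ⟨c, rfl⟩ := (Submodule.mem_span_range_iff_exists_fun ℝ).1 hy
    set D := (A.submatrix id f).det with hDdef
    let w := (A.submatrix id f).cramer (A.col j)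
    have hw : ∀ l, |w l| ≤ |D| := by
      intro l
      have : w l = (A.submatrix id (Function.update f l j)).det := by
        change (A.submatrix id f).cramer (A.col j) l = _
        rw [Matrix.cramer_apply]
        congr 1
        ext a b
        by_cases hb : b = l
        · subst hb; simp [Matrix.col]
        · simp [Matrix.updateCol_ne hb, Function.update_of_ne hb]
      rw [this]
      exact hf _ (Finset.mem_univ _)
    have hcr : ∀ i, ∑ l, v i (f l) * w l = D * v i j := by
      intro i
      have := congrFun (Matrix.mulVec_cramer (A.submatrix id f) (A.col j)) i
      simpa [Matrix.mulVec, dotProduct, A] using this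
    have key : D * (∑ i, c i • v i) j = ∑ l, (∑ i, c i • v i) (f l) * w l := by
      simp only [Finset.sum_apply, Pi.smul_apply, smul_eq_mul, Finset.mul_sum, Finset.sum_mul]
      rw [Finset.sum_comm]
      apply Finset.sum_congr rfl
      intro i _
      have := hcr i
      calc D * (c i * v i j) = c i * (D * v i j) := by ring
        _ = ∑ l, c i * v i (f l) * w l := by
          rw [← this, Finset.mul_sum]
          simp [mul_assoc]
    generalize (∑ i, c i • v i) = y at key
    have : |D| * |y j| ≤ |D| * ∑ l, |y (f l)| := by
      rw [← abs_mul, key, Finset.mul_sum]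
      refine (Finset.abs_sum_le_sum_abs _ _).trans ?_
      apply Finset.sum_le_sum
      intro l _
      rw [abs_mul, mul_comm]
      exact mul_le_mul_of_nonneg_right (hw l) (abs_nonneg _)
    exact le_of_mul_le_mul_left this hD

theorem aux_count {d : ℕ} (M : AddSubgroup (Fin d → ℝ))
    (hM : ∀ y ∈ M, y ≠ 0 → 1 ≤ ‖y‖) (B : Fin d → ℝ) (hB : ∀ j, 1 ≤ B j) (N : ℕ)
    (hN : Module.finrank ℝ (Submodule.span ℝ (M : Set (Fin d → ℝ))) < N) :
    ∃ f : Fin (Module.finrank ℝ (Submodule.span ℝ (M : Set (Fin d → ℝ)))) → Fin d,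
      Function.Injective f ∧
      {y | y ∈ M ∧ ∀ j, |y j| < B j}.Finite ∧
      (({y | y ∈ M ∧ ∀ j, |y j| < B j}.ncard : ℕ) : ℝ) ≤ ∏ i, (4 * N * B (f i)) := by
  obtain ⟨f, hfi, hf⟩ := aux_minor (M : Set (Fin d → ℝ))
  refine ⟨f, hfi, ?_⟩
  revert f
  generalize Module.finrank ℝ (Submodule.span ℝ (M : Set (Fin d → ℝ))) = k at hN
  intro f hfi hf
  have hN1 : (1 : ℝ) ≤ N := by exact_mod_cast (by omega : 1 ≤ N)
  have hN0 : (0 : ℝ) < N := by linarith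
  set S := {y | y ∈ M ∧ ∀ j, |y j| < B j} with hS
  let F : (Fin d → ℝ) → (Fin k → ℤ) := fun y i => ⌊(N : ℝ) * y (f i)⌋
  let T : Finset (Fin k → ℤ) :=
    Fintype.piFinset fun i => Finset.Ico (-⌈(N : ℝ) * B (f i)⌉) ⌈(N : ℝ) * B (f i)⌉
  have hmaps : ∀ y ∈ S, F y ∈ (T : Set (Fin k → ℤ)) := by
    intro y hy
    simp only [T, Finset.mem_coe, Fintype.mem_piFinset, Finset.mem_Ico]
    intro i
    have hyi := abs_lt.1 (hy.2 (f i))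
    constructor
    · rw [Int.le_floor]
      push_cast
      have := Int.le_ceil ((N : ℝ) * B (f i))
      nlinarith
    · rw [Int.floor_lt]
      have := Int.le_ceil ((N : ℝ) * B (f i))
      nlinarith
  have hinj : Set.InjOn F S := by
    intro y hy y' hy' he
    by_contra hne
    have hmem : y - y' ∈ M := M.sub_mem hy.1 hy'.1
    have h1 := hM _ hmem (sub_ne_zero.2 hne)
    have h2 : ‖y - y'‖ < 1 := by
      rw [pi_norm_lt_iff one_pos]
      intro j
      rw [Real.norm_eq_abs]
      refine (hf _ (Submodule.subset_span hmem) j).trans_lt ?_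
      have h3 : ∀ i, |(y - y') (f i)| ≤ 1 / (N : ℝ) := by
        intro i
        have := Int.abs_sub_lt_one_of_floor_eq_floor (congrFun he i)
        rw [← mul_sub, abs_mul, abs_of_pos hN0] at this
        rw [le_div_iff₀ hN0, mul_comm]
        exact this.le
      calc ∑ i, |(y - y') (f i)| ≤ ∑ _i : Fin k, 1 / (N : ℝ) := Finset.sum_le_sum fun i _ => h3 i
        _ = k / N := by simp [div_eq_mul_inv]
        _ < 1 := by
          rw [div_lt_one hN0]
          exact_mod_cast hN
    linarith
  have hfin : S.Finite := Set.Finite.of_finite_image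
    (T.finite_toSet.subset (Set.image_subset_iff.2 hmaps)) hinj
  refine ⟨hfin, ?_⟩
  have hle := Set.ncard_le_ncard_of_injOn F hmaps hinj T.finite_toSet
  rw [Set.ncard_coe_finset] at hle
  have hle' : ((S.ncard : ℕ) : ℝ) ≤ (T.card : ℝ) := by exact_mod_cast hle
  refine hle'.trans ?_
  rw [Fintype.card_piFinset]
  push_cast
  apply Finset.prod_le_prod
  · intro i _; positivity
  · intro i _
    rw [Int.card_Ico]
    have hBi := hB (f i)
    have h1 : (1 : ℝ) ≤ N * B (f i) := by nlinarith
    have h2 := Int.ceil_lt_add_one ((N : ℝ) * B (f i))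
    have h3 : (0 : ℤ) ≤ ⌈(N : ℝ) * B (f i)⌉ := Int.ceil_nonneg (by linarith)
    have h4 : (((⌈(N : ℝ) * B (f i)⌉ - -⌈(N : ℝ) * B (f i)⌉).toNat : ℕ) : ℝ)
        = 2 * (⌈(N : ℝ) * B (f i)⌉ : ℝ) := by
      have : (((⌈(N : ℝ) * B (f i)⌉ - -⌈(N : ℝ) * B (f i)⌉).toNat : ℕ) : ℤ)
        = 2 * ⌈(N : ℝ) * B (f i)⌉ := by omega
      exact_mod_cast this
    rw [h4]
    linarith

theorem aux_exp {n k : ℕ} (r : Fin n → ℝ) (hr : r ∈ Weights n) (q u τ : ℝ) (hq : 0 ≤ q)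
    (hτ0 : 0 ≤ τ) (hτ : ∀ i, 0 < r i → τ ≤ r i) (hqu : (1 + τ) * q ≤ u)
    (hk : k ≤ n - zW r) (f : Fin k → Fin (n + 1)) (hf : Function.Injective f)
    (β : Fin (n + 1) → ℝ) (hβ0 : β 0 = u - q) (hβ : ∀ i : Fin n, β i.succ = r i * q) :
    ∑ i, β (f i) ≤ u - τ * q := by
  have hβn : ∀ j, 0 ≤ β j := by
    intro j
    refine Fin.cases ?_ (fun i => ?_) j
    · rw [hβ0]; nlinarith
    · rw [hβ]; exact mul_nonneg (hr.2 i) hq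
  have htot : ∑ j, β j = u := by
    rw [Fin.sum_univ_succ, hβ0]
    simp_rw [hβ]
    rw [← Finset.sum_mul, hr.1]; ring
  let P : Finset (Fin (n + 1)) :=
    insert 0 ((Finset.univ.filter fun i => ¬ r i = 0).map (Fin.succEmb n))
  have hP : P.card = n - zW r + 1 := by
    rw [Finset.card_insert_of_notMem (by simp [Fin.succ_ne_zero]), Finset.card_map]
    have := Finset.card_filter_add_card_filter_not (s := (Finset.univ : Finset (Fin n)))
      (fun i => r i = 0)
    simp only [Finset.card_univ, Fintype.card_fin] at this
    unfold zW
    omega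
  let S : Finset (Fin (n + 1)) := Finset.univ.map ⟨f, hf⟩
  have hS : S.card = k := by simp [S]
  obtain ⟨p, hpP, hpS⟩ := Finset.exists_mem_notMem_of_card_lt_card (s := S) (t := P) (by omega)
  have hp : τ * q ≤ β p := by
    rcases Finset.mem_insert.1 hpP with h | h
    · rw [h, hβ0]; linarith
    · obtain ⟨i, hi, rfl⟩ := Finset.mem_map.1 h
      have hi' : r i ≠ 0 := (Finset.mem_filter.1 hi).2
      have : 0 < r i := lt_of_le_of_ne (hr.2 i) (Ne.symm hi')
      change τ * q ≤ β i.succ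
      rw [hβ]
      exact mul_le_mul_of_nonneg_right (hτ i this) hq
  have hsum : ∑ i, β (f i) = ∑ j ∈ S, β j := by simp [S]
  have h2 : ∑ j ∈ insert p S, β j ≤ ∑ j, β j :=
    Finset.sum_le_univ_sum_of_nonneg hβn
  rw [Finset.sum_insert hpS, htot] at h2
  linarith

theorem stmt11 (n : ℕ) (b : ℝ) (hb : 1 < b) (r : Fin n → ℝ) (hr : r ∈ Weights n)
    (t : ℕ) (ht : 1 ≤ t) (u : ℝ)
    (hu1 : 1 ≤ (1 + tauW r)⁻¹ * u) (hu2 : (1 + tauW r)⁻¹ * u ≤ (t : ℝ))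
    (Λ : AddSubgroup (Fin (n + 1) → ℝ))
    (hdisc : ∃ ε > 0, ∀ x ∈ Λ, x ≠ 0 → ε ≤ ‖x‖)
    (hrank : Module.finrank ℝ
      (Submodule.span ℝ (Λ : Set (Fin (n + 1) → ℝ))) ≤ n - zW r)
    (hδ : 1 ≤ latDelta (latImage
      (gmat r b ((t : ℝ) - (⌊(1 + tauW r)⁻¹ * u⌋ : ℝ))) (Λ : Set (Fin (n + 1) → ℝ)))) :
    (latImage (gmat r b (t : ℝ)) (Λ : Set (Fin (n + 1) → ℝ)) ∩ PiBU n b u).Finite ∧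
    (((latImage (gmat r b (t : ℝ)) (Λ : Set (Fin (n + 1) → ℝ)) ∩ PiBU n b u).ncard : ℝ) ≤
      2 * cConst n * b ^ (tauW r) * b ^ ((1 + tauW r)⁻¹ * u)) := by
  have hb0 : 0 < b := by linarith
  have hτ0 : 0 ≤ tauW r := Real.sInf_nonneg (fun x hx => hx.1.le)
  have hτ : ∀ i, 0 < r i → tauW r ≤ r i := fun i hi =>
    csInf_le ⟨0, fun x hx => hx.1.le⟩ ⟨hi, i, rfl⟩
  generalize tauW r = τ at *
  set μ := (1 + τ)⁻¹ * u with hμ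
  have huμ : u = (1 + τ) * μ := by rw [hμ]; field_simp
  have hfl := Int.floor_le μ
  have hfl2 := Int.lt_floor_add_one μ
  have hq : (0 : ℝ) ≤ (⌊μ⌋ : ℝ) := by exact_mod_cast Int.floor_nonneg.2 (by linarith)
  generalize (⌊μ⌋ : ℝ) = q at *
  have hqu : (1 + τ) * q ≤ u := by rw [huμ]; gcongr
  let G : (Fin (n + 1) → ℝ) →ₗ[ℝ] (Fin (n + 1) → ℝ) := (gmat r b ((t : ℝ) - q)).mulVecLin
  let M : AddSubgroup (Fin (n + 1) → ℝ) := Λ.map G.toAddMonoidHom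
  have hM : ∀ y ∈ M, y ≠ 0 → 1 ≤ ‖y‖ := by
    rintro y ⟨v, hv, rfl⟩ hy
    have h1 := hδ.trans (iInf₂_le (G v) ⟨⟨v, hv, rfl⟩, hy⟩)
    exact_mod_cast h1
  have hfr : Module.finrank ℝ (Submodule.span ℝ (M : Set (Fin (n + 1) → ℝ))) ≤ n - zW r := by
    have : (M : Set (Fin (n + 1) → ℝ)) = G '' (Λ : Set (Fin (n + 1) → ℝ)) := rfl
    rw [this, ← Submodule.map_span]
    exact (Submodule.finrank_map_le _ _).trans hrank
  let β : Fin (n + 1) → ℝ := Fin.cases (u - q) fun i => r i * q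
  have hβn : ∀ j, 0 ≤ β j := by
    intro j
    refine Fin.cases ?_ (fun i => ?_) j
    · change 0 ≤ u - q; nlinarith
    · exact mul_nonneg (hr.2 i) hq
  obtain ⟨f, hfi, hfin, hcard⟩ := aux_count M hM (fun j => b ^ β j)
    (fun j => Real.one_le_rpow hb.le (hβn j)) (n + 1) (by omega)
  set S := {y | y ∈ M ∧ ∀ j, |y j| < b ^ β j} with hS
  have hsub : latImage (gmat r b (t : ℝ)) (Λ : Set (Fin (n + 1) → ℝ)) ∩ PiBU n b u ⊆
      (fun v => (gmat r b q).mulVec v) '' S := by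
    rintro x ⟨⟨v, hv, rfl⟩, hx0, hxi⟩
    refine ⟨G v, ⟨⟨v, hv, rfl⟩, ?_⟩, ?_⟩
    · intro j
      refine Fin.cases ?_ (fun i => ?_) j
      · change |(gmat r b ((t : ℝ) - q)).mulVec v 0| < b ^ (u - q)
        simp only [gmat, Matrix.mulVec_diagonal, Fin.cases_zero] at hx0 ⊢
        rw [abs_mul, abs_of_pos (Real.rpow_pos_of_pos hb0 _)] at hx0 ⊢
        rw [Real.rpow_sub hb0, Real.rpow_sub hb0, div_mul_eq_mul_div]
        exact div_lt_div_of_pos_right hx0 (Real.rpow_pos_of_pos hb0 _)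
      · change |(gmat r b ((t : ℝ) - q)).mulVec v i.succ| < b ^ (r i * q)
        have hxi := hxi i
        simp only [gmat, Matrix.mulVec_diagonal, Fin.cases_succ] at hxi ⊢
        rw [abs_mul, abs_of_pos (Real.rpow_pos_of_pos hb0 _)] at hxi ⊢
        have : -(r i) * ((t : ℝ) - q) = r i * q + -(r i) * t := by ring
        rw [this, Real.rpow_add hb0, mul_assoc]
        have := Real.rpow_pos_of_pos hb0 (r i * q)
        nlinarith
    · funext j
      change (gmat r b q).mulVec ((gmat r b ((t : ℝ) - q)).mulVec v) j = (gmat r b t).mulVec v j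
      simp only [gmat, Matrix.mulVec_diagonal]
      rw [← mul_assoc]
      congr 1
      refine Fin.cases ?_ (fun i => ?_) j
      · simp only [Fin.cases_zero]
        rw [← Real.rpow_add hb0]; congr 1; ring
      · simp only [Fin.cases_succ]
        rw [← Real.rpow_add hb0]; congr 1; ring
  have hfin2 := hfin.image (fun v => (gmat r b q).mulVec v)
  refine ⟨hfin2.subset hsub, ?_⟩
  have hc1 := (Set.ncard_le_ncard hsub hfin2).trans (Set.ncard_image_le hfin)
  have hc2 : ((latImage (gmat r b (t : ℝ)) (Λ : Set (Fin (n + 1) → ℝ)) ∩ PiBU n b u).ncard : ℝ)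
      ≤ (S.ncard : ℝ) := by exact_mod_cast hc1
  refine hc2.trans (hcard.trans ?_)
  rw [Finset.prod_mul_distrib, ← Real.rpow_sum_of_pos hb0]
  have hexp := aux_exp r hr q u τ hq hτ0 hτ hqu hfr f hfi β rfl (fun _ => rfl)
  have hexp2 : ∑ i, β (f i) ≤ τ + μ := by nlinarith
  have h1 : b ^ (∑ i, β (f i)) ≤ b ^ τ * b ^ μ := by
    rw [← Real.rpow_add hb0]
    exact Real.rpow_le_rpow_of_exponent_le hb.le hexp2
  have h2 : ∏ _i : Fin (Module.finrank ℝ (Submodule.span ℝ (M : Set (Fin (n + 1) → ℝ)))),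
      (4 * ((n + 1 : ℕ) : ℝ)) ≤ cConst n := by
    rw [Finset.prod_const, Finset.card_univ, Fintype.card_fin]
    refine le_trans ?_ (aux_const n)
    push_cast
    apply pow_le_pow_right₀
    · have : (0 : ℝ) ≤ n := by positivity
      linarith
    · omega
  have hc0 : 0 ≤ cConst n := le_trans (by positivity) (aux_const n)
  have hb1 : 0 ≤ b ^ τ * b ^ μ := by positivity
  calc _ ≤ cConst n * (b ^ τ * b ^ μ) := mul_le_mul h2 h1 (by positivity) hc0
    _ ≤ 2 * cConst n * b ^ τ * b ^ μ := by nlinarith [mul_nonneg hc0 hb1]
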